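/- arXiv:math/0503516 — 3 statements merged into one kernel-verified Lean document; each statement's English description precedes it below -/
import Mathlib

section
/- The space V_S equipped with ‖·‖_S is a Banach space: ‖·‖_S is a norm on V_S (vanishing exactly on the class of functions equal to zero μ-a.e.), and V_S is complete with respect to ‖·‖_S, i.e., every ‖·‖_S-Cauchy sequence in V_S converges in ‖·‖_S to an element of V_S. (Proposition 3.3 of the paper: (V^M_κ, ‖·‖_M) is a Banach space, with the set M_κ of optional measures induced by the equivalent local martingale measures abstracted to an arbitrary nonempty set S of probability measures equivalent to μ; the proof uses only these properties of M_κ.) -/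
open MeasureTheory Filter Topology
open scoped ENNReal NNReal

/-- The norm `‖c‖_S = sup_{ν ∈ S} ∫ |c| dν` (as an extended nonnegative real). -/
noncomputable def nrmS {X : Type*} [MeasurableSpace X] (S : Set (Measure X)) (c : X → ℝ) :
    ℝ≥0∞ :=
  ⨆ ν ∈ S, ∫⁻ x, ‖c x‖₊ ∂ν

section SupNorm

variable {X : Type*} [MeasurableSpace X] {S : Set (Measure X)}

theorem lintegral_le_nrmS {ν : Measure X} (hν : ν ∈ S) (c : X → ℝ) :
    ∫⁻ x, ‖c x‖₊ ∂ν ≤ nrmS S c :=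
  le_iSup₂ (f := fun (ν : Measure X) (_ : ν ∈ S) => ∫⁻ x, (‖c x‖₊ : ℝ≥0∞) ∂ν) ν hν

theorem nrmS_eq_zero_iff {μ : Measure X} (hS : S.Nonempty)
    (hequiv : ∀ ν ∈ S, ν ≪ μ ∧ μ ≪ ν) {c : X → ℝ} (hc : Measurable c) :
    nrmS S c = 0 ↔ c =ᵐ[μ] 0 := by
  have key (ν : Measure X) : ∫⁻ x, ‖c x‖₊ ∂ν = 0 ↔ c =ᵐ[ν] 0 := by
    rw [lintegral_eq_zero_iff (by fun_prop)]
    simp [Filter.EventuallyEq]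
  constructor
  · intro h
    obtain ⟨ν, hν⟩ := hS
    have h0 : ∫⁻ x, ‖c x‖₊ ∂ν = 0 := le_antisymm (h ▸ lintegral_le_nrmS hν c) zero_le
    exact (hequiv ν hν).2.ae_eq ((key ν).1 h0)
  · intro h
    simp only [nrmS, ENNReal.iSup_eq_zero]
    exact fun ν hν => (key ν).2 ((hequiv ν hν).1.ae_eq h)

theorem nrmS_add_le {c₁ : X → ℝ} (c₂ : X → ℝ) (h₁ : Measurable c₁) :
    nrmS S (c₁ + c₂) ≤ nrmS S c₁ + nrmS S c₂ := by
  refine iSup₂_le fun ν hν => ?_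
  calc ∫⁻ x, ‖(c₁ + c₂) x‖₊ ∂ν
      ≤ ∫⁻ x, ((‖c₁ x‖₊ : ℝ≥0∞) + ‖c₂ x‖₊) ∂ν :=
        lintegral_mono fun x => mod_cast enorm_add_le (c₁ x) (c₂ x)
    _ = ∫⁻ x, ‖c₁ x‖₊ ∂ν + ∫⁻ x, ‖c₂ x‖₊ ∂ν := lintegral_add_left (by fun_prop) _
    _ ≤ nrmS S c₁ + nrmS S c₂ :=
        add_le_add (lintegral_le_nrmS hν c₁) (lintegral_le_nrmS hν c₂)

theorem nrmS_smul (a : ℝ) {c : X → ℝ} (hc : Measurable c) :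
    nrmS S (a • c) = (‖a‖₊ : ℝ≥0∞) * nrmS S c := by
  simp only [nrmS, ENNReal.mul_iSup]
  refine iSup_congr fun ν => iSup_congr fun _ => ?_
  rw [← lintegral_const_mul _ (by fun_prop)]
  simp

/-- A sequence whose successive tails are geometrically small in `‖·‖_S` converges almost
everywhere for each measure in `S`. -/
theorem ae_exists_tendsto_of_nrmS_lt {ν : Measure X} (hν : ν ∈ S) {c : ℕ → X → ℝ}
    (hc : ∀ n, Measurable (c n))
    (h : ∀ N n m, N ≤ n → N ≤ m → nrmS S (c n - c m) < (2⁻¹ : ℝ≥0∞) ^ N) :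
    ∀ᵐ x ∂ν, ∃ l, Tendsto (fun n => c n x) atTop (𝓝 l) := by
  refine Lp.ae_tendsto_of_cauchy_eLpNorm (p := 1) (B := fun N => (2⁻¹ : ℝ≥0∞) ^ N)
    (fun n => (hc n).aestronglyMeasurable) le_rfl ?_ fun N n m hn hm => ?_
  · simp [ENNReal.tsum_geometric]
  · rw [eLpNorm_one_eq_lintegral_enorm]
    exact (lintegral_le_nrmS hν (c n - c m)).trans_lt (h N n m hn hm)

/-- Lower semicontinuity of `‖·‖_S` under almost everywhere convergence. -/
theorem nrmS_le_of_tendsto_ae {f : ℕ → X → ℝ} {g : X → ℝ} {C : ℝ≥0∞}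
    (hf : ∀ n, Measurable (f n)) (hC : ∀ᶠ n in atTop, nrmS S (f n) ≤ C)
    (hlim : ∀ ν ∈ S, ∀ᵐ x ∂ν, Tendsto (fun n => f n x) atTop (𝓝 (g x))) :
    nrmS S g ≤ C := by
  refine iSup₂_le fun ν hν => ?_
  calc ∫⁻ x, ‖g x‖₊ ∂ν = ∫⁻ x, liminf (fun n => (‖f n x‖₊ : ℝ≥0∞)) atTop ∂ν := by
        refine lintegral_congr_ae ?_
        filter_upwards [hlim ν hν] with x hx
        exact (ENNReal.tendsto_coe.2 hx.nnnorm).liminf_eq.symm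
    _ ≤ liminf (fun n => ∫⁻ x, ‖f n x‖₊ ∂ν) atTop :=
        lintegral_liminf_le fun n => by fun_prop
    _ ≤ C := by
        refine liminf_le_of_frequently_le' (Eventually.frequently ?_)
        filter_upwards [hC] with n hn
        exact (lintegral_le_nrmS hν (f n)).trans hn

theorem exists_tendsto_nrmS_of_cauchy {μ : Measure X} (hS : S.Nonempty)
    (hequiv : ∀ ν ∈ S, ν ≪ μ ∧ μ ≪ ν) {c : ℕ → X → ℝ} (hc : ∀ n, Measurable (c n))
    (hfin : ∀ n, nrmS S (c n) < ⊤)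
    (hcau : ∀ ε : ℝ, 0 < ε → ∃ N : ℕ, ∀ m ≥ N, ∀ n ≥ N,
      nrmS S (c m - c n) < ENNReal.ofReal ε) :
    ∃ c₀ : X → ℝ, Measurable c₀ ∧ nrmS S c₀ < ⊤ ∧
      Tendsto (fun n => nrmS S (c n - c₀)) atTop (𝓝 0) := by
  have hsub : ∀ N : ℕ, ∀ᶠ k in atTop, ∀ m ≥ k, ∀ n ≥ k,
      nrmS S (c m - c n) < (2⁻¹ : ℝ≥0∞) ^ N := by
    intro N
    obtain ⟨K, hK⟩ := hcau ((2⁻¹ : ℝ) ^ N) (by positivity)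
    have hpow : ENNReal.ofReal ((2⁻¹ : ℝ) ^ N) = (2⁻¹ : ℝ≥0∞) ^ N := by
      rw [ENNReal.ofReal_pow (by norm_num), ENNReal.ofReal_inv_of_pos (by norm_num)]
      norm_num
    rw [hpow] at hK
    filter_upwards [eventually_ge_atTop K] with k hk m hm n hn
    exact hK m (hk.trans hm) n (hk.trans hn)
  obtain ⟨φ, hφ, hφc⟩ := extraction_forall_of_eventually hsub
  obtain ⟨ν₀, hν₀⟩ := hS
  have hex := ae_exists_tendsto_of_nrmS_lt hν₀ (fun n => hc (φ n)) fun N n m hn hm =>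
    hφc N _ (hφ.monotone hn) _ (hφ.monotone hm)
  obtain ⟨c₀, hc₀, hlim₀⟩ :=
    measurable_limit_of_tendsto_metrizable_ae (fun n => (hc (φ n)).aemeasurable) hex
  have hlim : ∀ ν ∈ S, ∀ᵐ x ∂ν, Tendsto (fun n => c (φ n) x) atTop (𝓝 (c₀ x)) :=
    fun ν hν => ((hequiv ν hν).1.trans (hequiv ν₀ hν₀).2).ae_le hlim₀
  have hbound : ∀ ε : ℝ, 0 < ε → ∃ N : ℕ, ∀ m ≥ N, nrmS S (c m - c₀) ≤ ENNReal.ofReal ε := by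
    intro ε hε
    obtain ⟨N, hN⟩ := hcau ε hε
    refine ⟨N, fun m hm => nrmS_le_of_tendsto_ae (fun n => (hc m).sub (hc (φ n))) ?_
      fun ν hν => ?_⟩
    · filter_upwards [eventually_ge_atTop N] with n hn
      exact (hN m hm _ (hn.trans (hφ.le_apply))).le
    · filter_upwards [hlim ν hν] with x hx
      exact hx.const_sub (c m x)
  refine ⟨c₀, hc₀, ?_, ?_⟩
  · obtain ⟨N, hN⟩ := hbound 1 one_pos
    have hneg : c₀ = c N + (-1 : ℝ) • (c N - c₀) := by
      ext x
      simp
    rw [hneg]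
    refine (nrmS_add_le _ (hc N)).trans_lt (ENNReal.add_lt_top.2 ⟨hfin N, ?_⟩)
    rw [nrmS_smul _ ((hc N).sub hc₀)]
    exact ENNReal.mul_lt_top ENNReal.coe_lt_top ((hN N le_rfl).trans_lt ENNReal.ofReal_lt_top)
  · refine ENNReal.tendsto_nhds_zero.2 fun ε hε => ?_
    obtain ⟨δ, -, hδ, hδε⟩ := ENNReal.lt_iff_exists_real_btwn.1 hε
    obtain ⟨N, hN⟩ := hbound δ (ENNReal.ofReal_pos.1 hδ)
    filter_upwards [eventually_ge_atTop N] with n hn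
    exact (hN n hn).trans hδε.le

end SupNorm

/-- **Proposition 3.3**: `(V_S, ‖·‖_S)` is a Banach space: `‖·‖_S` is a norm on `V_S`
(vanishing exactly on the functions equal to `0` μ-a.e., subadditive and absolutely
homogeneous), and every `‖·‖_S`-Cauchy sequence of elements of `V_S` converges in
`‖·‖_S` to an element of `V_S`. -/
theorem statement0 {X : Type*} [MeasurableSpace X] (μ : Measure X) [IsProbabilityMeasure μ]
    (S : Set (Measure X)) (hS : S.Nonempty)
    (hprob : ∀ ν ∈ S, IsProbabilityMeasure ν)
    (hequiv : ∀ ν ∈ S, ν ≪ μ ∧ μ ≪ ν) :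
    (∀ c : X → ℝ, Measurable c → (nrmS S c = 0 ↔ c =ᵐ[μ] 0)) ∧
    (∀ c₁ c₂ : X → ℝ, Measurable c₁ → Measurable c₂ →
      nrmS S (c₁ + c₂) ≤ nrmS S c₁ + nrmS S c₂) ∧
    (∀ (a : ℝ) (c : X → ℝ), Measurable c → nrmS S (a • c) = (‖a‖₊ : ℝ≥0∞) * nrmS S c) ∧
    (∀ c : ℕ → X → ℝ, (∀ n, Measurable (c n)) → (∀ n, nrmS S (c n) < ⊤) →
      (∀ ε : ℝ, 0 < ε → ∃ N : ℕ, ∀ m ≥ N, ∀ n ≥ N,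
        nrmS S (c m - c n) < ENNReal.ofReal ε) →
      ∃ c₀ : X → ℝ, Measurable c₀ ∧ nrmS S c₀ < ⊤ ∧
        Tendsto (fun n => nrmS S (c n - c₀)) atTop (nhds 0)) := by
  exact ⟨fun _ hc => nrmS_eq_zero_iff hS hequiv hc, fun _ c₂ h₁ _ => nrmS_add_le c₂ h₁,
    fun a _ hc => nrmS_smul a hc, fun _ hc hfin hcau =>
      exists_tendsto_nrmS_of_cauchy hS hequiv hc hfin hcau⟩
end

section
/- For every ξ < 0, the integral defining H_ξ(x) converges and H_ξ(x) is finite and strictly positive for every x ≥ 0, and the ratio x ↦ H_{ξ−1}(x) / H_ξ(x) is bounded on [0, ∞), i.e., there exists a constant C > 0 such that H_{ξ−1}(x) ≤ C · H_ξ(x) for all x ≥ 0. (This is the boundedness on [0, ∞) of the function h(z) = (2β/α) · H_{−β/α−1}(z)/H_{−β/α}(z), with ξ = −β/α for α, β > 0, established in the proof of Proposition 5.5 of the paper; it implies that the optimal dual process (Z^{ν^x}_t) is a true martingale.) -/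
open MeasureTheory Filter Topology Real
open scoped ENNReal NNReal

/-- The Hermite function
`H_ξ(x) = (1/(2Γ(-ξ))) ∫₀^∞ e^{-s - 2x√s} s^{-ξ/2 - 1} ds` for `ξ < 0`, `x ≥ 0`. -/
noncomputable def hermiteFn (ξ x : ℝ) : ℝ :=
  (1 / (2 * Real.Gamma (-ξ))) *
    ∫ s in Set.Ioi (0 : ℝ), Real.exp (-s - 2 * x * Real.sqrt s) * s ^ (-ξ / 2 - 1)

/-- The integrand `e^{-s - 2x√s} s^{a - 1}` is integrable for `a > 0`, `x ≥ 0`: it is dominated by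
the integrand of the Gamma function. -/
theorem integrableOn_exp_neg_sub_mul_sqrt_mul_rpow {a x : ℝ} (ha : 0 < a) (hx : 0 ≤ x) :
    IntegrableOn (fun s : ℝ => Real.exp (-s - 2 * x * Real.sqrt s) * s ^ (a - 1))
      (Set.Ioi (0 : ℝ)) := by
  refine Integrable.mono' (Real.GammaIntegral_convergent ha) (by fun_prop) ?_
  refine (ae_restrict_iff' measurableSet_Ioi).2 (Eventually.of_forall fun s hs => ?_)
  have hs : 0 < s := hs
  rw [Real.norm_of_nonneg (by positivity)]
  gcongr
  have : 0 ≤ 2 * x * Real.sqrt s := by positivity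
  linarith

theorem integral_exp_neg_sub_mul_sqrt_mul_rpow_pos {a x : ℝ} (ha : 0 < a) (hx : 0 ≤ x) :
    0 < ∫ s in Set.Ioi (0 : ℝ), Real.exp (-s - 2 * x * Real.sqrt s) * s ^ (a - 1) := by
  rw [setIntegral_pos_iff_support_of_nonneg_ae _
    (integrableOn_exp_neg_sub_mul_sqrt_mul_rpow ha hx)]
  · rw [Set.inter_eq_right.2]
    · simp
    · intro s hs
      have hs : 0 < s := hs
      exact (by positivity : 0 < Real.exp (-s - 2 * x * Real.sqrt s) * s ^ (a - 1)).ne'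
  · refine (ae_restrict_iff' measurableSet_Ioi).2 (Eventually.of_forall fun s hs => ?_)
    have hs : 0 < s := hs
    simp only [Pi.zero_apply]
    positivity

/-- Chebyshev's association inequality for the Gamma weight `e^{-s} s^{a - 1}`, the increasing
function `√s` and the decreasing function `e^{-2x√s}`. -/
theorem integral_exp_neg_sub_mul_sqrt_mul_rpow_add_half_le {a x : ℝ} (ha : 0 < a) (hx : 0 ≤ x) :
    ∫ s in Set.Ioi (0 : ℝ), Real.exp (-s - 2 * x * Real.sqrt s) * s ^ (a + 1 / 2 - 1) ≤
      Real.Gamma (a + 1 / 2) / Real.Gamma a *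
        ∫ s in Set.Ioi (0 : ℝ), Real.exp (-s - 2 * x * Real.sqrt s) * s ^ (a - 1) := by
  have ha' : 0 < a + 1 / 2 := by linarith
  have hΓ : Real.Gamma a ≠ 0 := (Real.Gamma_pos_of_pos ha).ne'
  set c := Real.Gamma (a + 1 / 2) / Real.Gamma a with hc
  have hi := integrableOn_exp_neg_sub_mul_sqrt_mul_rpow ha hx
  have hi' := integrableOn_exp_neg_sub_mul_sqrt_mul_rpow ha' hx
  have hg := Real.GammaIntegral_convergent ha
  have hg' := Real.GammaIntegral_convergent ha'
  have hd : IntegrableOn (fun s : ℝ => Real.exp (-(2 * x * c)) *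
      (Real.exp (-s) * s ^ (a + 1 / 2 - 1) - c * (Real.exp (-s) * s ^ (a - 1))))
      (Set.Ioi (0 : ℝ)) := (hg'.sub (hg.const_mul c)).const_mul _
  have hle : ∫ s in Set.Ioi (0 : ℝ), Real.exp (-s - 2 * x * Real.sqrt s) * s ^ (a + 1 / 2 - 1) ≤
      ∫ s in Set.Ioi (0 : ℝ), (c * (Real.exp (-s - 2 * x * Real.sqrt s) * s ^ (a - 1)) +
        Real.exp (-(2 * x * c)) *
          (Real.exp (-s) * s ^ (a + 1 / 2 - 1) - c * (Real.exp (-s) * s ^ (a - 1)))) := by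
    refine setIntegral_mono_on hi'
      ((hi.const_mul c).add hd) measurableSet_Ioi ?_
    intro s hs
    have hs : 0 < s := hs
    have hpow : s ^ (a + 1 / 2 - 1) = Real.sqrt s * s ^ (a - 1) := by
      rw [Real.sqrt_eq_rpow, ← Real.rpow_add hs]
      congr 1
      ring
    have hexp : Real.exp (-s - 2 * x * Real.sqrt s) =
        Real.exp (-s) * Real.exp (-(2 * x * Real.sqrt s)) := by
      rw [← Real.exp_add, sub_eq_add_neg]
    have hcheb : (Real.sqrt s - c) *
        (Real.exp (-(2 * x * Real.sqrt s)) - Real.exp (-(2 * x * c))) ≤ 0 := by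
      rcases le_total (Real.sqrt s) c with h | h
      · refine mul_nonpos_of_nonpos_of_nonneg (by linarith) (sub_nonneg.2 ?_)
        gcongr
      · refine mul_nonpos_of_nonneg_of_nonpos (by linarith) (sub_nonpos.2 ?_)
        gcongr
    have hw : 0 ≤ Real.exp (-s) * s ^ (a - 1) := by positivity
    rw [hpow, hexp]
    linarith [mul_nonpos_of_nonneg_of_nonpos hw hcheb]
  refine hle.trans_eq ?_
  rw [integral_add (hi.const_mul c) hd,
    integral_const_mul, integral_const_mul, integral_sub hg' (hg.const_mul c),
    integral_const_mul, ← Real.Gamma_eq_integral ha, ← Real.Gamma_eq_integral ha',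
    hc, div_mul_cancel₀ _ hΓ, sub_self, mul_zero, add_zero]

/-- For every `ξ < 0`, the integral defining `H_ξ(x)` converges and `H_ξ(x)` is finite and
strictly positive for every `x ≥ 0`, and the ratio `H_{ξ-1}/H_ξ` is bounded on `[0, ∞)`:
there exists `C > 0` with `H_{ξ-1}(x) ≤ C · H_ξ(x)` for all `x ≥ 0`. -/
theorem statement6 (ξ : ℝ) (hξ : ξ < 0) :
    (∀ x : ℝ, 0 ≤ x →
      IntegrableOn (fun s : ℝ => Real.exp (-s - 2 * x * Real.sqrt s) * s ^ (-ξ / 2 - 1))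
        (Set.Ioi (0 : ℝ))) ∧
    (∀ x : ℝ, 0 ≤ x → 0 < hermiteFn ξ x) ∧
    (∃ C : ℝ, 0 < C ∧ ∀ x : ℝ, 0 ≤ x → hermiteFn (ξ - 1) x ≤ C * hermiteFn ξ x) := by
  have ha : 0 < -ξ / 2 := by linarith
  have hΓ : 0 < Real.Gamma (-ξ) := Real.Gamma_pos_of_pos (by linarith)
  have hΓ' : 0 < Real.Gamma (-(ξ - 1)) := Real.Gamma_pos_of_pos (by linarith)
  have hΓa : 0 < Real.Gamma (-ξ / 2) := Real.Gamma_pos_of_pos ha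
  have hΓa' : 0 < Real.Gamma (-ξ / 2 + 1 / 2) := Real.Gamma_pos_of_pos (by linarith)
  refine ⟨fun x hx => integrableOn_exp_neg_sub_mul_sqrt_mul_rpow ha hx, fun x hx => ?_,
    Real.Gamma (-ξ) / Real.Gamma (-(ξ - 1)) *
      (Real.Gamma (-ξ / 2 + 1 / 2) / Real.Gamma (-ξ / 2)), by positivity, fun x hx => ?_⟩
  · exact mul_pos (by positivity) (integral_exp_neg_sub_mul_sqrt_mul_rpow_pos ha hx)
  · have h := integral_exp_neg_sub_mul_sqrt_mul_rpow_add_half_le ha hx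
    unfold hermiteFn
    rw [show -(ξ - 1) / 2 - 1 = -ξ / 2 + 1 / 2 - 1 by ring]
    refine (mul_le_mul_of_nonneg_left h (by positivity)).trans_eq ?_
    field_simp
end

section
/- For every ξ < 0 there exists a constant D > 0 such that x · H_{ξ−1}(x) / H_ξ(x) → D as x → ∞; equivalently, the function h(x) := H_{ξ−1}(x)/H_ξ(x) satisfies h(x) ∼ D x^{−1} as x → ∞. (This asymptotic is established in the proof of Proposition 5.5 of the paper from the asymptotic behavior H_ξ(x) ∼ C_ξ x^ξ of the Hermite function as x → ∞.) -/
open MeasureTheory Filter Topology Real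
open scoped ENNReal NNReal

lemma integral_rpow_mul_exp_neg_two_mul_sqrt {a : ℝ} (ha : 0 < a) :
    ∫ t in Set.Ioi (0 : ℝ), t ^ (a / 2 - 1) * Real.exp (-2 * t ^ (1 / 2 : ℝ)) =
      2 ^ (-a) * (2 * Real.Gamma a) := by
  rw [integral_rpow_mul_exp_neg_mul_rpow (by norm_num) (by linarith) (by norm_num)]
  have h : (a / 2 - 1 + 1) / (1 / 2 : ℝ) = a := by ring
  have h' : -(a / 2 - 1 + 1) / (1 / 2 : ℝ) = -a := by ring
  rw [h, h']
  norm_num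
  ring

lemma rpow_mul_integral_exp_sub_sqrt_mul_rpow (a : ℝ) {x : ℝ} (hx : 0 < x) :
    x ^ a * ∫ s in Set.Ioi (0 : ℝ),
        Real.exp (-s - 2 * x * Real.sqrt s) * s ^ (a / 2 - 1) =
      ∫ t in Set.Ioi (0 : ℝ),
        Real.exp (-t / x ^ 2) * (t ^ (a / 2 - 1) * Real.exp (-2 * t ^ (1 / 2 : ℝ))) := by
  have h := integral_comp_mul_left_Ioi
    (fun t : ℝ => Real.exp (-t / x ^ 2) * (t ^ (a / 2 - 1) * Real.exp (-2 * t ^ (1 / 2 : ℝ))))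
    0 (pow_pos hx 2)
  rw [mul_zero, smul_eq_mul, inv_mul_eq_div, eq_div_iff (by positivity)] at h
  rw [← h, mul_comm (∫ _ in _, _), ← integral_const_mul, ← integral_const_mul]
  refine setIntegral_congr_fun measurableSet_Ioi fun s hs => ?_
  have hs' : (0 : ℝ) < s := hs
  have h1 : (x ^ 2 * s) ^ (a / 2 - 1) = x ^ a / x ^ 2 * s ^ (a / 2 - 1) := by
    rw [Real.mul_rpow (by positivity) hs'.le, ← Real.rpow_natCast x 2, ← Real.rpow_mul hx.le,
      ← Real.rpow_sub hx]
    congr 2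
    push_cast
    ring
  have h2 : (x ^ 2 * s) ^ (1 / 2 : ℝ) = x * Real.sqrt s := by
    rw [← Real.sqrt_eq_rpow, Real.sqrt_mul (by positivity), Real.sqrt_sq hx.le]
  have h3 : -(x ^ 2 * s) / x ^ 2 = -s := by field_simp
  have h4 : -s - 2 * x * Real.sqrt s = -s + -2 * (x * Real.sqrt s) := by ring
  simp only [h1, h2, h3, h4, Real.exp_add]
  field_simp

lemma tendsto_rpow_mul_hermiteFn {ξ : ℝ} (hξ : ξ < 0) :
    Tendsto (fun x : ℝ => x ^ (-ξ) * hermiteFn ξ x) atTop (𝓝 (2 ^ ξ)) := by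
  have ha : 0 < -ξ := neg_pos.2 hξ
  have hΓ := Real.Gamma_pos_of_pos ha
  have hJ := integral_rpow_mul_exp_neg_two_mul_sqrt ha
  rw [neg_neg] at hJ
  have hint : IntegrableOn
      (fun t : ℝ => t ^ (-ξ / 2 - 1) * Real.exp (-2 * t ^ (1 / 2 : ℝ))) (Set.Ioi 0) := by
    by_contra hc
    rw [integral_undef hc] at hJ
    exact absurd hJ (by positivity)
  have hlim : Tendsto (fun x : ℝ => ∫ t in Set.Ioi (0 : ℝ), Real.exp (-t / x ^ 2) *
      (t ^ (-ξ / 2 - 1) * Real.exp (-2 * t ^ (1 / 2 : ℝ)))) atTop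
      (𝓝 (2 ^ ξ * (2 * Real.Gamma (-ξ)))) := by
    rw [← hJ]
    refine tendsto_integral_filter_of_dominated_convergence _ (.of_forall fun x => ?_)
      (.of_forall fun x => ?_) hint ?_
    · exact (by fun_prop : Continuous fun t : ℝ => Real.exp (-t / x ^ 2)).aestronglyMeasurable.mul
        hint.aestronglyMeasurable
    · refine (ae_restrict_mem measurableSet_Ioi).mono fun t ht => ?_
      have ht' : (0 : ℝ) < t := ht
      rw [Real.norm_of_nonneg (by positivity)]
      refine mul_le_of_le_one_left (by positivity) (Real.exp_le_one_iff.2 ?_)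
      rw [neg_div]
      exact neg_nonpos.2 (by positivity)
    · refine .of_forall fun t => ?_
      have h := (Real.continuous_exp.tendsto 0).comp
        ((tendsto_pow_atTop (α := ℝ) two_ne_zero).const_div_atTop (-t))
      simpa using h.mul_const (t ^ (-ξ / 2 - 1) * Real.exp (-2 * t ^ (1 / 2 : ℝ)))
  have hmain := hlim.const_mul (1 / (2 * Real.Gamma (-ξ)))
  have hC : 1 / (2 * Real.Gamma (-ξ)) * (2 ^ ξ * (2 * Real.Gamma (-ξ))) = 2 ^ ξ := by
    field_simp
  rw [hC] at hmain
  refine hmain.congr' ((eventually_gt_atTop 0).mono fun x hx => ?_)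
  rw [← rpow_mul_integral_exp_sub_sqrt_mul_rpow (-ξ) hx]
  simp only [hermiteFn]
  ring

/-- For every `ξ < 0` there is a constant `D > 0` such that
`x · H_{ξ-1}(x) / H_ξ(x) → D` as `x → ∞`; equivalently, the ratio
`h(x) = H_{ξ-1}(x)/H_ξ(x)` satisfies `h(x) ∼ D x⁻¹` as `x → ∞`. -/
theorem statement7 (ξ : ℝ) (hξ : ξ < 0) :
    ∃ D : ℝ, 0 < D ∧
      Tendsto (fun x : ℝ => x * hermiteFn (ξ - 1) x / hermiteFn ξ x) atTop (nhds D) := by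
  refine ⟨2 ^ (ξ - 1) / 2 ^ ξ, by positivity, ?_⟩
  refine ((tendsto_rpow_mul_hermiteFn (by linarith : ξ - 1 < 0)).div
    (tendsto_rpow_mul_hermiteFn hξ) (by positivity)).congr'
    ((eventually_gt_atTop 0).mono fun x hx => ?_)
  have h : x ^ (-(ξ - 1)) = x ^ (-ξ) * x := by
    rw [← Real.rpow_add_one hx.ne']
    congr 1
    ring
  rw [Pi.div_apply, h, mul_assoc, mul_div_mul_left _ _ (Real.rpow_pos_of_pos hx _).ne']
end
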